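/- arXiv:1501.02074 — 2 statements merged into one kernel-verified Lean document; each statement's English description precedes it below -/
import Mathlib

section
/- Let 1/3 < γ ≤ 1/2, let 𝒜 be a Banach algebra with unit 1, T ∈ (0,∞], and let 𝐀 = (A¹,A²) be a bounded γ-rough driver in 𝒜 on [0,T). For each s ∈ [0,T) let t ↦ e^𝐀_{ts} (t ∈ [s,T)) be the unique γ-Hölder (on bounded intervals) path in 𝒜 with e^𝐀_{ss} = 1 such that the 2-index map e^𝐀_{ts} − e^𝐀_{us} − (A¹_{tu}+A²_{tu}) e^𝐀_{us} (s ≤ u ≤ t) is locally 3γ-Hölder. Then the flow property e^𝐀_{ts} = e^𝐀_{tu} e^𝐀_{us} holds for all 0 ≤ s ≤ u ≤ t < T. -/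
/-!
STATEMENT 4 (flow property of `e^𝐀`).
With the notions of bounded γ-rough driver on `[0,T)` (`T : EReal`) as in the
context, suppose that for each `s ∈ [0,T)` the path `t ↦ e t s` on `[s,T)`
starts at `1`, is γ-Hölder on bounded intervals, and has locally 3γ-Hölder
remainder `e t s - e u s - (A1 t u + A2 t u) * e u s`; then
`e t s = e t u * e u s` for all `0 ≤ s ≤ u ≤ t < T`.
-/

/-- Chen's relations for a pair of 2-index maps on `[0,T)`. -/
def ChenRelations {A : Type} [NormedRing A] (T : EReal)
    (A1 A2 : ℝ → ℝ → A) : Prop :=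
  ∀ s u t : ℝ, 0 ≤ s → s ≤ u → u ≤ t → (t : EReal) < T →
    A1 t s = A1 t u + A1 u s ∧
    A2 t s = A2 t u + A2 u s + A1 t u * A1 u s

/-- `K` is an upper bound for the rough-driver norm `‖𝐀‖`. -/
def DriverNormBound {A : Type} [NormedRing A] (γ : ℝ) (T : EReal)
    (A1 A2 : ℝ → ℝ → A) (K : ℝ) : Prop :=
  ∀ s t : ℝ, 0 ≤ s → s ≤ t → (t : EReal) < T → t - s ≤ 1 →
    ‖A1 t s‖ ≤ K * (t - s) ^ γ ∧ ‖A2 t s‖ ≤ K * (t - s) ^ (2 * γ)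

/-- A 2-index map `b`, defined for `s ≤ u ≤ t < T` with base point `s`,
is locally `β`-Hölder on `[s,T)`. -/
def LocallyHolderFrom {E : Type} [NormedAddCommGroup E] (β : ℝ) (s : ℝ) (T : EReal)
    (b : ℝ → ℝ → E) : Prop :=
  ∀ S : ℝ, (S : EReal) < T → ∃ C : ℝ, ∀ u t : ℝ,
    s ≤ u → u ≤ t → t ≤ S → t - u ≤ 1 → ‖b t u‖ ≤ C * (t - u) ^ β

/-- The remainder `g t - g s - (A¹ + A²) t s * g s` of a path `g` along a rough driver. -/
def roughRemainder {A : Type} [NormedRing A] (A1 A2 : ℝ → ℝ → A) (g : ℝ → A) (t s : ℝ) : A :=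
  g t - g s - (A1 t s + A2 t s) * g s

/-- Under Chen's relations, the increment of the remainder involves only products of regularity
at least `3γ`. -/
theorem roughRemainder_split {A : Type} [NormedRing A] {A1 A2 : ℝ → ℝ → A} (g : ℝ → A)
    {s u t : ℝ} (h1 : A1 t s = A1 t u + A1 u s)
    (h2 : A2 t s = A2 t u + A2 u s + A1 t u * A1 u s) :
    roughRemainder A1 A2 g t s = roughRemainder A1 A2 g t u + roughRemainder A1 A2 g u s +
      (A1 t u * (roughRemainder A1 A2 g u s + A2 u s * g s) +
        A2 t u * (roughRemainder A1 A2 g u s + (A1 u s + A2 u s) * g s)) := by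
  simp only [roughRemainder, h1, h2]
  noncomm_ring

theorem norm_roughRemainder_le_of_split {A : Type} [NormedRing A] {A1 A2 : ℝ → ℝ → A}
    {g : ℝ → A} {s u t K M x y : ℝ} (hK : 0 ≤ K) (hM : 0 ≤ M) (hx : 0 ≤ x) (hxy : x ≤ y)
    (hy : y ≤ 1) (h1 : A1 t s = A1 t u + A1 u s)
    (h2 : A2 t s = A2 t u + A2 u s + A1 t u * A1 u s)
    (hA1tu : ‖A1 t u‖ ≤ K * x) (hA2tu : ‖A2 t u‖ ≤ K * x ^ 2)
    (hA1us : ‖A1 u s‖ ≤ K * x) (hA2us : ‖A2 u s‖ ≤ K * x ^ 2)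
    (htu : ‖roughRemainder A1 A2 g t u‖ ≤ M * x ^ 3)
    (hus : ‖roughRemainder A1 A2 g u s‖ ≤ M * x ^ 3) (hgs : ‖g s‖ ≤ M * y ^ 3) :
    ‖roughRemainder A1 A2 g t s‖ ≤ ((2 * K + 3 * K ^ 2) * y + 2) * M * x ^ 3 := by
  have hy0 : 0 ≤ y := hx.trans hxy
  have hx1 : x ≤ 1 := hxy.trans hy
  have hy3 : y ^ 3 ≤ y := pow_le_of_le_one hy0 hy (by norm_num)
  have hx2 : x ^ 2 ≤ x := pow_le_of_le_one hx hx1 (by norm_num)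
  have hgs' : ‖g s‖ ≤ M * y := hgs.trans (by gcongr)
  have e1 : ‖A1 t u * (roughRemainder A1 A2 g u s + A2 u s * g s)‖
      ≤ K * x * (M * x ^ 3 + K * x ^ 2 * (M * y)) := by
    refine (norm_mul_le _ _).trans ?_
    gcongr
    refine (norm_add_le _ _).trans ?_
    gcongr
    refine (norm_mul_le _ _).trans ?_
    gcongr
  have e2 : ‖A2 t u * (roughRemainder A1 A2 g u s + (A1 u s + A2 u s) * g s)‖
      ≤ K * x ^ 2 * (M * x ^ 3 + (K * x + K * x ^ 2) * (M * y)) := by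
    refine (norm_mul_le _ _).trans ?_
    gcongr
    refine (norm_add_le _ _).trans ?_
    gcongr
    refine (norm_mul_le _ _).trans ?_
    gcongr
    exact (norm_add_le _ _).trans (add_le_add hA1us hA2us)
  rw [roughRemainder_split g h1 h2]
  refine (norm_add_le _ _).trans ((add_le_add (norm_add_le _ _) (norm_add_le _ _)).trans ?_)
  have e3 : K * x * (M * x ^ 3) ≤ K * M * x ^ 3 * y := by
    calc K * x * (M * x ^ 3) = K * M * x ^ 3 * x := by ring
      _ ≤ _ := by gcongr
  have e4 : K * x ^ 2 * (M * x ^ 3) ≤ K * M * x ^ 3 * y := by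
    calc K * x ^ 2 * (M * x ^ 3) = K * M * x ^ 3 * x ^ 2 := by ring
      _ ≤ _ := by gcongr; exact hx2.trans hxy
  have e5 : K * x ^ 2 * (K * x ^ 2 * (M * y)) ≤ K ^ 2 * M * x ^ 3 * y := by
    calc K * x ^ 2 * (K * x ^ 2 * (M * y)) = K ^ 2 * M * (x ^ 3 * x) * y := by ring
      _ ≤ K ^ 2 * M * (x ^ 3 * 1) * y := by gcongr
      _ = _ := by ring
  linarith

/-- A path started from `0` whose remainder along a rough driver is bounded by `M (t-s)^{3γ}` on
`[a,b]` satisfies the same bound with `M` multiplied by an explicit factor, obtained by splitting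
each interval at its midpoint. -/
theorem roughRemainder_bound_improve {A : Type} [NormedRing A] {γ K a b h M : ℝ}
    {A1 A2 : ℝ → ℝ → A} {g : ℝ → A} (hγ : 0 < γ) (hK : 0 ≤ K) (hM : 0 ≤ M)
    (hbh : b - a ≤ h) (hh0 : 0 ≤ h) (hh : h ≤ 1)
    (hChen : ∀ s u t : ℝ, a ≤ s → s ≤ u → u ≤ t → t ≤ b →
      A1 t s = A1 t u + A1 u s ∧ A2 t s = A2 t u + A2 u s + A1 t u * A1 u s)
    (hA : ∀ s t : ℝ, a ≤ s → s ≤ t → t ≤ b →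
      ‖A1 t s‖ ≤ K * (t - s) ^ γ ∧ ‖A2 t s‖ ≤ K * (t - s) ^ (2 * γ))
    (hga : g a = 0)
    (hR : ∀ s t : ℝ, a ≤ s → s ≤ t → t ≤ b →
      ‖roughRemainder A1 A2 g t s‖ ≤ M * (t - s) ^ (3 * γ))
    {s t : ℝ} (has : a ≤ s) (hst : s ≤ t) (htb : t ≤ b) :
    ‖roughRemainder A1 A2 g t s‖ ≤
      ((2 * K + 3 * K ^ 2) * h ^ γ + 2) / 2 ^ (3 * γ) * M * (t - s) ^ (3 * γ) := by
  have hpow2 : ∀ r : ℝ, 0 ≤ r → r ^ (2 * γ) = (r ^ γ) ^ 2 := fun r hr => by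
    rw [mul_comm, ← Real.rpow_mul_natCast hr]; norm_num
  have hpow3 : ∀ r : ℝ, 0 ≤ r → r ^ (3 * γ) = (r ^ γ) ^ 3 := fun r hr => by
    rw [mul_comm, ← Real.rpow_mul_natCast hr]; norm_num
  have hd : 0 ≤ (t - s) / 2 := by linarith
  have hgs : ‖g s‖ ≤ M * (h ^ γ) ^ 3 := by
    have := hR a s le_rfl has (hst.trans htb)
    simp only [roughRemainder, hga, mul_zero, sub_zero] at this
    rw [← hpow3 h hh0]
    refine this.trans ?_
    have : 0 ≤ s - a := by linarith
    gcongr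
    linarith
  have hu1 : (s + t) / 2 - s = (t - s) / 2 := by ring
  have hu2 : t - (s + t) / 2 = (t - s) / 2 := by ring
  have hsu : s ≤ (s + t) / 2 := by linarith
  have hut : (s + t) / 2 ≤ t := by linarith
  obtain ⟨h1, h2⟩ := hChen s _ t has hsu hut htb
  have htu := hR _ t (has.trans hsu) hut htb
  have hus := hR s _ has hsu (hut.trans htb)
  obtain ⟨hA1tu, hA2tu⟩ := hA _ t (has.trans hsu) hut htb
  obtain ⟨hA1us, hA2us⟩ := hA s _ has hsu (hut.trans htb)
  rw [hu2, hpow3 _ hd] at htu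
  rw [hu1, hpow3 _ hd] at hus
  rw [hu2] at hA1tu
  rw [hu1] at hA1us
  rw [hu2, hpow2 _ hd] at hA2tu
  rw [hu1, hpow2 _ hd] at hA2us
  have key := norm_roughRemainder_le_of_split hK hM (Real.rpow_nonneg hd γ)
    (Real.rpow_le_rpow hd (by linarith) hγ.le) (Real.rpow_le_one hh0 hh hγ.le) h1 h2
    hA1tu hA2tu hA1us hA2us htu hus hgs
  refine key.trans (le_of_eq ?_)
  rw [← hpow3 _ hd, Real.div_rpow (by linarith) (by norm_num)]
  ring

/-- On a short enough interval, a path started from `0` with `3γ`-Hölder remainder along a rough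
driver vanishes. -/
theorem eq_zero_of_roughRemainder_bound {A : Type} [NormedRing A] {γ K a b h C : ℝ}
    {A1 A2 : ℝ → ℝ → A} {g : ℝ → A} (hγ : 0 < γ) (hK : 0 ≤ K) (hC : 0 ≤ C) (hab : a ≤ b)
    (hbh : b - a ≤ h) (hh : h ≤ 1)
    (hsmall : (2 * K + 3 * K ^ 2) * h ^ γ + 2 < 2 ^ (3 * γ))
    (hChen : ∀ s u t : ℝ, a ≤ s → s ≤ u → u ≤ t → t ≤ b →
      A1 t s = A1 t u + A1 u s ∧ A2 t s = A2 t u + A2 u s + A1 t u * A1 u s)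
    (hA : ∀ s t : ℝ, a ≤ s → s ≤ t → t ≤ b →
      ‖A1 t s‖ ≤ K * (t - s) ^ γ ∧ ‖A2 t s‖ ≤ K * (t - s) ^ (2 * γ))
    (hga : g a = 0)
    (hR : ∀ s t : ℝ, a ≤ s → s ≤ t → t ≤ b →
      ‖roughRemainder A1 A2 g t s‖ ≤ C * (t - s) ^ (3 * γ)) :
    g b = 0 := by
  have hh0 : 0 ≤ h := by linarith
  set θ : ℝ := ((2 * K + 3 * K ^ 2) * h ^ γ + 2) / 2 ^ (3 * γ) with hθ
  have hθ0 : 0 ≤ θ := by positivity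
  have hθ1 : θ < 1 := (div_lt_one (by positivity)).2 hsmall
  have hiter : ∀ n : ℕ, ∀ s t : ℝ, a ≤ s → s ≤ t → t ≤ b →
      ‖roughRemainder A1 A2 g t s‖ ≤ θ ^ n * C * (t - s) ^ (3 * γ) := by
    intro n
    induction n with
    | zero => simpa using hR
    | succ n ih =>
      intro s t has hst htb
      have := roughRemainder_bound_improve hγ hK (by positivity) hbh hh0 hh hChen hA hga ih
        has hst htb
      rwa [← hθ, ← mul_assoc, ← pow_succ'] at this
  have hlim : Filter.Tendsto (fun n : ℕ => θ ^ n * C * (b - a) ^ (3 * γ)) Filter.atTop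
      (nhds (0 * C * (b - a) ^ (3 * γ))) :=
    ((tendsto_pow_atTop_nhds_zero_of_lt_one hθ0 hθ1).mul_const _).mul_const _
  have hle := ge_of_tendsto' hlim fun n => hiter n a b le_rfl hab le_rfl
  simpa [roughRemainder, hga] using hle

theorem exists_small_step {γ K : ℝ} (hγ : 1 / 3 < γ) :
    ∃ h : ℝ, 0 < h ∧ h ≤ 1 ∧ (2 * K + 3 * K ^ 2) * h ^ γ + 2 < 2 ^ (3 * γ) := by
  have hγ0 : 0 < γ := by linarith
  have hp : (2 : ℝ) < 2 ^ (3 * γ) := by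
    simpa using Real.rpow_lt_rpow_of_exponent_lt (x := 2) (by norm_num)
      (show (1 : ℝ) < 3 * γ by linarith)
  have hcont : Filter.Tendsto (fun h : ℝ => (2 * K + 3 * K ^ 2) * h ^ γ + 2)
      (nhdsWithin 0 (Set.Ioi 0)) (nhds 2) := by
    have : Continuous fun h : ℝ => (2 * K + 3 * K ^ 2) * h ^ γ + 2 :=
      ((Real.continuous_rpow_const hγ0.le).const_mul _).add_const _
    simpa [Real.zero_rpow hγ0.ne'] using (this.tendsto 0).mono_left nhdsWithin_le_nhds
  obtain ⟨h, hlt, hpos, hle⟩ := ((hcont.eventually_lt_const hp).and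
    (Ioc_mem_nhdsGT (zero_lt_one' ℝ))).exists
  exact ⟨h, hpos, hle, hlt⟩

theorem flow_property_bounded_rough_driver
    (γ : ℝ) (hγ1 : 1 / 3 < γ) (hγ2 : γ ≤ 1 / 2)
    (A : Type) [NormedRing A] [NormedAlgebra ℝ A] [CompleteSpace A]
    (T : EReal) (hT : 0 < T)
    (A1 A2 : ℝ → ℝ → A)
    (hChen : ChenRelations T A1 A2)
    (hNorm : ∃ K : ℝ, DriverNormBound γ T A1 A2 K)
    (e : ℝ → ℝ → A)
    (hinit : ∀ s : ℝ, 0 ≤ s → (s : EReal) < T → e s s = 1)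
    (hHolder : ∀ s : ℝ, 0 ≤ s → (s : EReal) < T →
      LocallyHolderFrom γ s T (fun t u => e t s - e u s))
    (hRem : ∀ s : ℝ, 0 ≤ s → (s : EReal) < T →
      LocallyHolderFrom (3 * γ) s T
        (fun t u => e t s - e u s - (A1 t u + A2 t u) * e u s)) :
    ∀ s u t : ℝ, 0 ≤ s → s ≤ u → u ≤ t → (t : EReal) < T →
      e t s = e t u * e u s := by
  obtain ⟨K₀, hK₀⟩ := hNorm
  have hγ0 : 0 < γ := by linarith
  intro s u t hs hsu hut htT
  have hu : 0 ≤ u := hs.trans hsu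
  have hlt : ∀ r : ℝ, r ≤ t → (r : EReal) < T := fun r hr =>
    (EReal.coe_le_coe_iff.2 hr).trans_lt htT
  obtain ⟨C₁, hC₁⟩ := hRem s hs (hlt s (hsu.trans hut)) t htT
  obtain ⟨C₂, hC₂⟩ := hRem u hu (hlt u hut) t htT
  obtain ⟨h, hh0, hh1, hsmall⟩ := exists_small_step (K := |K₀|) hγ1
  set g : ℝ → A := fun r => e r s - e r u * e u s with hg
  have hR : ∀ q r : ℝ, u ≤ q → q ≤ r → r ≤ t → r - q ≤ 1 →
      ‖roughRemainder A1 A2 g r q‖ ≤ (|C₁| + |C₂| * ‖e u s‖) * (r - q) ^ (3 * γ) := by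
    intro q r huq hqr hrt hd
    have hd0 : 0 ≤ (r - q) ^ (3 * γ) := Real.rpow_nonneg (by linarith) _
    have h1 := (hC₁ q r (hsu.trans huq) hqr hrt hd).trans
      (mul_le_mul_of_nonneg_right (le_abs_self C₁) hd0)
    have h2 := (hC₂ q r huq hqr hrt hd).trans
      (mul_le_mul_of_nonneg_right (le_abs_self C₂) hd0)
    have hsplit : roughRemainder A1 A2 g r q =
        (e r s - e q s - (A1 r q + A2 r q) * e q s) -
          (e r u - e q u - (A1 r q + A2 r q) * e q u) * e u s := by
      simp only [roughRemainder, hg]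
      noncomm_ring
    rw [hsplit]
    refine (norm_sub_le _ _).trans ?_
    have h3 := (norm_mul_le (e r u - e q u - (A1 r q + A2 r q) * e q u) (e u s)).trans
      (mul_le_mul_of_nonneg_right h2 (norm_nonneg _))
    linarith
  have hzero : ∀ n : ℕ, ∀ r : ℝ, u ≤ r → r ≤ t → r ≤ u + n * h → g r = 0 := by
    intro n
    induction n with
    | zero =>
      intro r hur hrt hrn
      obtain rfl : r = u := le_antisymm (by simpa using hrn) hur
      simp [hg, hinit r hu (hlt r hut)]
    | succ n ih =>
      intro r hur hrt hrn
      push_cast at hrn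
      have hua : u ≤ max u (r - h) := le_max_left _ _
      have har : max u (r - h) ≤ r := max_le hur (by linarith)
      have hra : r - max u (r - h) ≤ h := by linarith [le_max_right u (r - h)]
      have hga : g (max u (r - h)) = 0 := by
        refine ih _ hua (har.trans hrt) (max_le ?_ (by linarith))
        have : 0 ≤ (n : ℝ) * h := by positivity
        linarith
      refine eq_zero_of_roughRemainder_bound (A1 := A1) (A2 := A2)
        (C := |C₁| + |C₂| * ‖e u s‖) hγ0 (abs_nonneg K₀)
        (by positivity) har hra hh1 hsmall ?_ ?_ hga ?_
      · intro p q v hp hpq hqv hv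
        exact hChen p q v (by linarith) hpq hqv (hlt v (by linarith))
      · intro p q hp hpq hq
        have hd : 0 ≤ q - p := by linarith
        obtain ⟨h1, h2⟩ := hK₀ p q (by linarith) hpq (hlt q (by linarith)) (by linarith)
        exact ⟨h1.trans (by gcongr; exact le_abs_self K₀),
          h2.trans (by gcongr; exact le_abs_self K₀)⟩
      · intro p q hp hpq hq
        exact hR p q (by linarith) hpq (by linarith) (by linarith)
  obtain ⟨n, hn⟩ := exists_nat_ge ((t - u) / h)
  have := hzero n t hut le_rfl (by rw [div_le_iff₀ hh0] at hn; linarith)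
  exact sub_eq_zero.1 this
end

section
/- Let 1/3 < γ ≤ 1/2, let 𝒜 be a Banach algebra with unit 1, T ∈ (0,∞], and let 𝐀 = (A¹,A²) be a bounded γ-rough driver in 𝒜 on [0,T). Then there exists a sequence (Aⁿ)_{n≥1} of 𝒜-valued 2-index maps on [0,T) whose first two terms are A¹ and A², satisfying δAⁿ_{tus} = Σ_{k=1}^{n−1} A^{n−k}_{tu} A^{k}_{us} for all n ≥ 2 and 0 ≤ s ≤ u ≤ t < T, and such that, for some constant C depending only on γ and ‖𝐀‖, sup { |Aⁿ_{ts}|/(t−s)^{nγ} : 0 ≤ s < t < T, t−s ≤ 1 } ≤ Cⁿ (n!)^{−γ} for every n ≥ 1. Consequently, with A⁰_{ts} := 1, the series e^𝐀_{ts} := Σ_{n≥0} Aⁿ_{ts} converges absolutely in 𝒜 for all 0 ≤ s ≤ t < T, satisfies the flow property e^𝐀_{ts} = e^𝐀_{tu} e^𝐀_{us} for s ≤ u ≤ t, and for each fixed s the path t ↦ e^𝐀_{ts} is γ-Hölder on bounded intervals with e^𝐀_{ts} − e^𝐀_{us} − (A¹_{tu}+A²_{tu}) e^𝐀_{us} locally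 3γ-Hölder. -/
section Sewing

variable {E : Type*} [NormedAddCommGroup E]

/-- The increment `δμ` of a 2-index map. -/
def increment (μ : ℝ → ℝ → E) (t u s : ℝ) : E := μ t s - μ t u - μ u s

/-- `δμ` is bounded by `M (t - s) ^ θ` at scale one on `[0,T)`. -/
def IncrementBound (T : EReal) (θ M : ℝ) (μ : ℝ → ℝ → E) : Prop :=
  ∀ s u t : ℝ, 0 ≤ s → s ≤ u → u ≤ t → (t : EReal) < T → t - s ≤ 1 →
    ‖increment μ t u s‖ ≤ M * (t - s) ^ θ

/-- Riemann sum of `μ` over `[0,t]` along the dyadic grid of mesh `2⁻ᴺ`. -/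
noncomputable def gridSum (μ : ℝ → ℝ → E) (N : ℕ) (t : ℝ) : E :=
  ∑ j ∈ Finset.range ⌊2 ^ N * t⌋₊, μ ((j + 1) / 2 ^ N) (j / 2 ^ N)
    + μ t (⌊2 ^ N * t⌋₊ / 2 ^ N)

/-- The change of the Riemann sum when the grid is refined once. -/
noncomputable def gridError (μ : ℝ → ℝ → E) (N : ℕ) (t : ℝ) : E :=
  ∑ j ∈ Finset.range ⌊2 ^ N * t⌋₊,
      increment μ ((j + 1) / 2 ^ N) ((2 * j + 1) / 2 ^ (N + 1)) (j / 2 ^ N)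
    + if ⌊2 ^ (N + 1) * t⌋₊ = 2 * ⌊2 ^ N * t⌋₊ then 0
      else increment μ t ((2 * ⌊2 ^ N * t⌋₊ + 1) / 2 ^ (N + 1)) (⌊2 ^ N * t⌋₊ / 2 ^ N)

lemma floor_two_pow_succ_mul {t : ℝ} (ht : 0 ≤ t) (N : ℕ) :
    ⌊2 ^ (N + 1) * t⌋₊ = 2 * ⌊2 ^ N * t⌋₊ ∨ ⌊2 ^ (N + 1) * t⌋₊ = 2 * ⌊2 ^ N * t⌋₊ + 1 := by
  have h0 : 0 ≤ 2 ^ N * t := by positivity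
  have h1 := Nat.floor_le h0
  have h2 := Nat.lt_floor_add_one (2 ^ N * t)
  have e : (2 : ℝ) ^ (N + 1) * t = 2 * (2 ^ N * t) := by ring
  have h3 : 2 * ⌊2 ^ N * t⌋₊ ≤ ⌊2 ^ (N + 1) * t⌋₊ := by
    apply Nat.le_floor
    push_cast
    linarith
  have h4 : ⌊2 ^ (N + 1) * t⌋₊ < 2 * ⌊2 ^ N * t⌋₊ + 2 := by
    rw [Nat.floor_lt (by positivity)]
    push_cast
    linarith
  omega

lemma gridSum_succ (μ : ℝ → ℝ → E) (N : ℕ) {t : ℝ} (ht : 0 ≤ t) :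
    gridSum μ (N + 1) t = gridSum μ N t - gridError μ N t := by
  have key : ∀ p : ℕ, ∑ j ∈ Finset.range (2 * p), μ ((j + 1) / 2 ^ (N + 1)) (j / 2 ^ (N + 1))
      = ∑ j ∈ Finset.range p, μ ((j + 1) / 2 ^ N) (j / 2 ^ N)
        - ∑ j ∈ Finset.range p,
          increment μ ((j + 1) / 2 ^ N) ((2 * j + 1) / 2 ^ (N + 1)) (j / 2 ^ N) := by
    intro p
    induction p with
    | zero => simp
    | succ p ih =>
      rw [show 2 * (p + 1) = 2 * p + 1 + 1 by ring, Finset.sum_range_succ, Finset.sum_range_succ,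
        ih, Finset.sum_range_succ, Finset.sum_range_succ, increment]
      have e1 : ((2 * p : ℕ) : ℝ) / 2 ^ (N + 1) = p / 2 ^ N := by
        push_cast; field_simp; ring
      have e2 : (((2 * p + 1 : ℕ) : ℝ) + 1) / 2 ^ (N + 1) = (p + 1) / 2 ^ N := by
        push_cast; field_simp; ring
      rw [e1, e2]
      push_cast
      abel
  have e1 : ((2 * ⌊2 ^ N * t⌋₊ : ℕ) : ℝ) / 2 ^ (N + 1) = ⌊2 ^ N * t⌋₊ / 2 ^ N := by
    push_cast; field_simp; ring
  unfold gridSum gridError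
  rcases floor_two_pow_succ_mul ht N with h | h
  · rw [if_pos h, h, key, e1]
    abel
  · rw [if_neg (by omega), h, Finset.sum_range_succ, key, e1, increment]
    push_cast
    abel

variable {T : EReal} {θ M : ℝ} {μ : ℝ → ℝ → E}

lemma EReal.coe_lt_of_le_of_lt {s t : ℝ} (h : s ≤ t) (ht : (t : EReal) < T) : (s : EReal) < T :=
  (EReal.coe_le_coe_iff.2 h).trans_lt ht

lemma IncrementBound.norm_le_mesh (hμ : IncrementBound T θ M μ) (hM : 0 ≤ M) (hθ : 0 ≤ θ)
    {s u t : ℝ} (hs : 0 ≤ s) (hsu : s ≤ u) (hut : u ≤ t) (ht : (t : EReal) < T) (N : ℕ)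
    (hN : t - s ≤ (1 / 2) ^ N) : ‖increment μ t u s‖ ≤ M * ((1 / 2 : ℝ) ^ N) ^ θ :=
  (hμ s u t hs hsu hut ht (hN.trans (pow_le_one₀ (by norm_num) (by norm_num)))).trans <| by
    gcongr
    linarith

lemma norm_gridError_sub_le (hμ : IncrementBound T θ M μ) (hM : 0 ≤ M) (hθ : 0 ≤ θ)
    {s t : ℝ} (hs : 0 ≤ s) (hst : s ≤ t) (ht : (t : EReal) < T) (N : ℕ) :
    ‖gridError μ N t - gridError μ N s‖
      ≤ (2 ^ N * (t - s) + 3) * (M * ((1 / 2 : ℝ) ^ N) ^ θ) := by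
  set B := M * ((1 / 2 : ℝ) ^ N) ^ θ
  have hB : 0 ≤ B := by positivity
  have h2N : (0 : ℝ) < 2 ^ N := by positivity
  have hlast : ∀ r : ℝ, 0 ≤ r → r ≤ t →
      ‖(if ⌊2 ^ (N + 1) * r⌋₊ = 2 * ⌊2 ^ N * r⌋₊ then 0
      else increment μ r ((2 * ⌊2 ^ N * r⌋₊ + 1) / 2 ^ (N + 1)) (⌊2 ^ N * r⌋₊ / 2 ^ N))‖ ≤ B := by
    intro r hr hrt
    split_ifs with h
    · simpa using hB
    · have h' := (floor_two_pow_succ_mul hr N).resolve_left h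
      have h1 := Nat.floor_le (show 0 ≤ 2 ^ (N + 1) * r by positivity)
      have h2 := Nat.lt_floor_add_one (2 ^ N * r)
      rw [h'] at h1
      push_cast at h1
      refine hμ.norm_le_mesh hM hθ (by positivity) ?_ ?_ (EReal.coe_lt_of_le_of_lt hrt ht) N ?_
      · rw [div_le_div_iff₀ (by positivity) (by positivity), pow_succ]
        nlinarith
      · rw [div_le_iff₀ (by positivity)]
        linarith
      · rw [sub_le_iff_le_add, one_div, inv_pow, inv_eq_one_div, ← add_div,
          le_div_iff₀ (by positivity)]
        linarith
  have hfl : ⌊2 ^ N * s⌋₊ ≤ ⌊2 ^ N * t⌋₊ := Nat.floor_mono (by gcongr)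
  have hsum : ‖∑ j ∈ Finset.Ico ⌊2 ^ N * s⌋₊ ⌊2 ^ N * t⌋₊,
      increment μ ((j + 1) / 2 ^ N) ((2 * j + 1) / 2 ^ (N + 1)) (j / 2 ^ N)‖
        ≤ (2 ^ N * (t - s) + 1) * B := by
    refine (norm_sum_le_of_le _ (f := fun j : ℕ ↦ increment μ ((j + 1) / 2 ^ N)
      ((2 * j + 1) / 2 ^ (N + 1)) (j / 2 ^ N)) (n := fun _ ↦ B) ?_).trans ?_
    · intro j hj
      have hj2 : j + 1 ≤ ⌊2 ^ N * t⌋₊ := (Finset.mem_Ico.1 hj).2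
      have hj3 : ((j : ℝ) + 1) / 2 ^ N ≤ t := by
        rw [div_le_iff₀ h2N, mul_comm]
        calc (j : ℝ) + 1 = ((j + 1 : ℕ) : ℝ) := by push_cast; rfl
          _ ≤ ⌊2 ^ N * t⌋₊ := by exact_mod_cast hj2
          _ ≤ 2 ^ N * t := Nat.floor_le (mul_nonneg h2N.le (hs.trans hst))
      refine hμ.norm_le_mesh hM hθ (by positivity) ?_ ?_ (EReal.coe_lt_of_le_of_lt hj3 ht) N ?_
      · rw [div_le_div_iff₀ (by positivity) (by positivity), pow_succ]
        nlinarith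
      · rw [div_le_div_iff₀ (by positivity) (by positivity), pow_succ]
        nlinarith
      · rw [← sub_div, one_div, inv_pow, add_sub_cancel_left, one_div]
    · rw [Finset.sum_const, Nat.card_Ico, nsmul_eq_mul, Nat.cast_sub hfl]
      gcongr
      have h1 := Nat.floor_le (show 0 ≤ 2 ^ N * t from mul_nonneg h2N.le (hs.trans hst))
      have h2 := Nat.lt_floor_add_one (2 ^ N * s)
      linarith
  have e : gridError μ N t - gridError μ N s
      = ∑ j ∈ Finset.Ico ⌊2 ^ N * s⌋₊ ⌊2 ^ N * t⌋₊,
          increment μ ((j + 1) / 2 ^ N) ((2 * j + 1) / 2 ^ (N + 1)) (j / 2 ^ N)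
        + (if ⌊2 ^ (N + 1) * t⌋₊ = 2 * ⌊2 ^ N * t⌋₊ then 0
          else increment μ t ((2 * ⌊2 ^ N * t⌋₊ + 1) / 2 ^ (N + 1)) (⌊2 ^ N * t⌋₊ / 2 ^ N))
        - (if ⌊2 ^ (N + 1) * s⌋₊ = 2 * ⌊2 ^ N * s⌋₊ then 0
          else increment μ s ((2 * ⌊2 ^ N * s⌋₊ + 1) / 2 ^ (N + 1)) (⌊2 ^ N * s⌋₊ / 2 ^ N)) := by
    rw [Finset.sum_Ico_eq_sub _ hfl, gridError, gridError]
    abel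
  rw [e]
  refine (norm_sub_le _ _).trans ((add_le_add (norm_add_le _ _) le_rfl).trans ?_)
  linarith [hlast s hs hst, hlast t (hs.trans hst) le_rfl]

lemma norm_gridSum_sub_sub_le (hμ : IncrementBound T θ M μ) (hM : 0 ≤ M) (hθ : 0 ≤ θ)
    {s t : ℝ} (hs : 0 ≤ s) (hst : s ≤ t) (ht : (t : EReal) < T) (N : ℕ)
    (hN : t - s ≤ (1 / 2) ^ N) :
    ‖gridSum μ N t - gridSum μ N s - μ t s‖ ≤ 2 * (M * ((1 / 2 : ℝ) ^ N) ^ θ) := by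
  set B := M * ((1 / 2 : ℝ) ^ N) ^ θ
  have hB : 0 ≤ B := by positivity
  have h2N : (0 : ℝ) < 2 ^ N := by positivity
  have ht0 := hs.trans hst
  have hfl : ⌊2 ^ N * s⌋₊ ≤ ⌊2 ^ N * t⌋₊ := Nat.floor_mono (by gcongr)
  have hs1 := Nat.floor_le (show 0 ≤ 2 ^ N * s by positivity)
  have hs2 := Nat.lt_floor_add_one (2 ^ N * s)
  have ht1 := Nat.floor_le (show 0 ≤ 2 ^ N * t by positivity)
  have ht2 := Nat.lt_floor_add_one (2 ^ N * t)
  have hN' : 2 ^ N * t ≤ 2 ^ N * s + 1 := by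
    have : 2 ^ N * (t - s) ≤ 2 ^ N * (1 / 2 : ℝ) ^ N := by gcongr
    rw [← mul_pow] at this
    norm_num at this
    linarith
  have hfl' : ⌊2 ^ N * t⌋₊ ≤ ⌊2 ^ N * s⌋₊ + 1 := by
    have : ⌊2 ^ N * t⌋₊ < ⌊2 ^ N * s⌋₊ + 2 := by
      rw [Nat.floor_lt (by positivity)]
      push_cast
      linarith
    omega
  have hinv : (1 / 2 : ℝ) ^ N = 1 / 2 ^ N := by rw [one_div, inv_pow, one_div]
  have hsT := EReal.coe_lt_of_le_of_lt hst ht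
  rcases (show ⌊2 ^ N * t⌋₊ = ⌊2 ^ N * s⌋₊ ∨ ⌊2 ^ N * t⌋₊ = ⌊2 ^ N * s⌋₊ + 1 by omega) with h | h
  · have e : gridSum μ N t - gridSum μ N s - μ t s
        = increment μ t s (⌊2 ^ N * s⌋₊ / 2 ^ N) := by
      rw [gridSum, gridSum, h, increment]
      abel
    rw [e]
    rw [h] at ht2
    have := hμ.norm_le_mesh hM hθ (s := ⌊2 ^ N * s⌋₊ / 2 ^ N) (by positivity)
      (by rw [div_le_iff₀ h2N]; linarith) hst ht N
      (by rw [hinv, sub_le_iff_le_add, ← add_div, le_div_iff₀ h2N]; linarith)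
    linarith
  · have e : gridSum μ N t - gridSum μ N s - μ t s
        = increment μ ((⌊2 ^ N * s⌋₊ + 1) / 2 ^ N) s (⌊2 ^ N * s⌋₊ / 2 ^ N)
          - increment μ t ((⌊2 ^ N * s⌋₊ + 1) / 2 ^ N) s := by
      rw [gridSum, gridSum, h, increment, increment, Finset.sum_range_succ]
      push_cast
      abel
    rw [h] at ht1
    push_cast at ht1
    have hbt : ((⌊2 ^ N * s⌋₊ : ℝ) + 1) / 2 ^ N ≤ t := by rw [div_le_iff₀ h2N]; linarith
    have hsb : s ≤ ((⌊2 ^ N * s⌋₊ : ℝ) + 1) / 2 ^ N := by rw [le_div_iff₀ h2N]; linarith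
    have h1 := hμ.norm_le_mesh hM hθ (s := ⌊2 ^ N * s⌋₊ / 2 ^ N) (by positivity)
      (by rw [div_le_iff₀ h2N]; linarith) hsb (EReal.coe_lt_of_le_of_lt hbt ht) N
      (by rw [hinv, ← sub_div, add_sub_cancel_left])
    have h2 := hμ.norm_le_mesh hM hθ hs hsb hbt ht N hN
    rw [e]
    exact (norm_sub_le _ _).trans (by linarith)

lemma half_pow_rpow (θ : ℝ) (N : ℕ) : ((1 / 2 : ℝ) ^ N) ^ θ = ((1 / 2 : ℝ) ^ θ) ^ N := by
  rw [← Real.rpow_natCast, ← Real.rpow_mul (by norm_num), mul_comm, Real.rpow_mul (by norm_num),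
    Real.rpow_natCast]

lemma two_mul_half_rpow_lt_one (hθ : 1 < θ) : 2 * (1 / 2 : ℝ) ^ θ < 1 := by
  have := Real.rpow_lt_rpow_of_exponent_gt (x := (1 / 2 : ℝ)) (by norm_num) (by norm_num) hθ
  rw [Real.rpow_one] at this
  linarith

lemma gridError_zero (μ : ℝ → ℝ → E) (N : ℕ) : gridError μ N 0 = 0 := by
  simp [gridError]

/-- The limit of the dyadic Riemann sums over `[0,t]`. -/
noncomputable def sewnPath (μ : ℝ → ℝ → E) (t : ℝ) : E :=
  Filter.limUnder Filter.atTop fun N ↦ gridSum μ N t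

lemma tendsto_gridSum [CompleteSpace E] (hμ : IncrementBound T θ M μ) (hM : 0 ≤ M) (hθ : 1 < θ)
    {t : ℝ} (ht0 : 0 ≤ t) (ht : (t : EReal) < T) :
    Filter.Tendsto (fun N ↦ gridSum μ N t) Filter.atTop (nhds (sewnPath μ t)) := by
  refine CauchySeq.tendsto_limUnder (cauchySeq_of_summable_dist ?_)
  have hq := two_mul_half_rpow_lt_one hθ
  refine Summable.of_nonneg_of_le (fun _ ↦ dist_nonneg) (fun N ↦ ?_)
    ((summable_geometric_of_lt_one (by positivity) hq).mul_left ((t + 3) * M))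
  have h := norm_gridError_sub_le hμ hM (by linarith) le_rfl ht0 ht N
  rw [gridError_zero, sub_zero, sub_zero] at h
  rw [Nat.succ_eq_add_one, gridSum_succ μ N ht0, dist_eq_norm, sub_sub_cancel]
  refine h.trans ?_
  rw [half_pow_rpow, mul_pow]
  have h1 : (1 : ℝ) ≤ 2 ^ N := one_le_pow₀ (by norm_num)
  have h2 : 0 ≤ M * ((1 / 2 : ℝ) ^ θ) ^ N := by positivity
  nlinarith

lemma norm_gridSum_add_sub_sub_le (hμ : IncrementBound T θ M μ) (hM : 0 ≤ M) (hθ : 0 ≤ θ)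
    {s t : ℝ} (hs : 0 ≤ s) (hst : s ≤ t) (ht : (t : EReal) < T) (N k : ℕ)
    (hN : t - s ≤ (1 / 2) ^ N) :
    ‖gridSum μ (N + k) t - gridSum μ (N + k) s - μ t s‖
      ≤ (2 + 4 * ∑ i ∈ Finset.range k, (2 * (1 / 2 : ℝ) ^ θ) ^ i)
        * (M * ((1 / 2 : ℝ) ^ N) ^ θ) := by
  induction k with
  | zero => simpa using norm_gridSum_sub_sub_le hμ hM hθ hs hst ht N hN
  | succ k ih =>
    have h := norm_gridError_sub_le hμ hM hθ hs hst ht (N + k)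
    have h2 : (2 : ℝ) ^ (N + k) * (t - s) ≤ 2 ^ k := by
      calc (2 : ℝ) ^ (N + k) * (t - s) ≤ 2 ^ (N + k) * (1 / 2) ^ N := by gcongr
        _ = 2 ^ k := by rw [pow_add, mul_right_comm, ← mul_pow]; norm_num
    have h1 : (1 : ℝ) ≤ 2 ^ k := one_le_pow₀ (by norm_num)
    have e : gridSum μ (N + (k + 1)) t - gridSum μ (N + (k + 1)) s - μ t s
        = gridSum μ (N + k) t - gridSum μ (N + k) s - μ t s
          - (gridError μ (N + k) t - gridError μ (N + k) s) := by
      rw [← add_assoc, gridSum_succ μ _ hs, gridSum_succ μ _ (hs.trans hst)]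
      abel
    rw [e, Finset.sum_range_succ]
    refine (norm_sub_le _ _).trans ((add_le_add ih h).trans ?_)
    have h3 : M * ((1 / 2 : ℝ) ^ (N + k)) ^ θ
        = M * ((1 / 2 : ℝ) ^ N) ^ θ * ((1 / 2 : ℝ) ^ θ) ^ k := by
      rw [half_pow_rpow, half_pow_rpow, pow_add, mul_assoc]
    have h4 : 0 ≤ M * ((1 / 2 : ℝ) ^ N) ^ θ * ((1 / 2 : ℝ) ^ θ) ^ k := by positivity
    rw [h3, mul_pow]
    nlinarith

lemma norm_sewnPath_sub_sub_le_mesh [CompleteSpace E] (hμ : IncrementBound T θ M μ) (hM : 0 ≤ M)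
    (hθ : 1 < θ) {s t : ℝ} (hs : 0 ≤ s) (hst : s ≤ t) (ht : (t : EReal) < T) (N : ℕ)
    (hN : t - s ≤ (1 / 2) ^ N) :
    ‖sewnPath μ t - sewnPath μ s - μ t s‖
      ≤ (2 + 4 * (1 - 2 * (1 / 2 : ℝ) ^ θ)⁻¹) * (M * ((1 / 2 : ℝ) ^ N) ^ θ) := by
  have hlim := (((tendsto_gridSum hμ hM hθ (hs.trans hst) ht).sub
    (tendsto_gridSum hμ hM hθ hs (EReal.coe_lt_of_le_of_lt hst ht))).sub_const (μ t s)).norm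
  refine le_of_tendsto hlim ?_
  filter_upwards [Filter.eventually_ge_atTop N] with n hn
  obtain ⟨k, rfl⟩ := Nat.exists_eq_add_of_le hn
  refine (norm_gridSum_add_sub_sub_le hμ hM (by linarith) hs hst ht N k hN).trans ?_
  have hq := two_mul_half_rpow_lt_one hθ
  have hq0 : 0 ≤ 2 * (1 / 2 : ℝ) ^ θ := by positivity
  gcongr
  rw [← tsum_geometric_of_lt_one hq0 hq]
  exact (summable_geometric_of_lt_one hq0 hq).sum_le_tsum _ fun i _ ↦ by positivity

/-- Sewing lemma: the increments of `sewnPath μ` approximate `μ` with the sharp dyadic constant. -/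
lemma norm_sewnPath_sub_sub_le [CompleteSpace E] (hμ : IncrementBound T θ M μ) (hM : 0 ≤ M)
    (hθ : 1 < θ) {s t : ℝ} (hs : 0 ≤ s) (hst : s ≤ t) (ht : (t : EReal) < T) (hts : t - s ≤ 1) :
    ‖sewnPath μ t - sewnPath μ s - μ t s‖
      ≤ M * (1 - 2 * (1 / 2 : ℝ) ^ θ)⁻¹ * (t - s) ^ θ := by
  set q := 2 * (1 / 2 : ℝ) ^ θ with hqdef
  have hq : q < 1 := two_mul_half_rpow_lt_one hθ
  have hq0 : 0 ≤ q := by positivity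
  have hq1 : 1 - q ≠ 0 := by linarith
  set B := (2 + 4 * (1 - q)⁻¹) * M * 2 ^ θ
  have coarse : ∀ s t : ℝ, 0 ≤ s → s ≤ t → (t : EReal) < T → t - s ≤ 1 →
      ‖sewnPath μ t - sewnPath μ s - μ t s‖ ≤ B * (t - s) ^ θ := by
    intro s t hs hst ht hts
    rcases hst.eq_or_lt with rfl | hst'
    · have h := hμ s s s hs le_rfl le_rfl ht hts
      have h0 : (0 : ℝ) ^ θ = 0 := Real.zero_rpow (by linarith)
      simp only [increment, sub_self, h0, mul_zero, zero_sub, norm_neg] at h ⊢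
      exact h
    · obtain ⟨N, h1, h2⟩ := exists_nat_pow_near_of_lt_one (sub_pos.2 hst') hts
        (show (0 : ℝ) < 1 / 2 by norm_num) (by norm_num)
      refine (norm_sewnPath_sub_sub_le_mesh hμ hM hθ hs hst ht N h2).trans ?_
      have h3 : ((1 / 2 : ℝ) ^ N) ^ θ ≤ 2 ^ θ * (t - s) ^ θ := by
        rw [← Real.mul_rpow (by norm_num) (by linarith)]
        refine Real.rpow_le_rpow (by positivity) ?_ (by linarith)
        rw [pow_succ] at h1
        linarith
      have hi : 0 < (1 - q)⁻¹ := inv_pos.2 (by linarith)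
      calc _ ≤ (2 + 4 * (1 - q)⁻¹) * (M * (2 ^ θ * (t - s) ^ θ)) := by gcongr
        _ = _ := by ring
  have refined : ∀ n : ℕ, ∀ s t : ℝ, 0 ≤ s → s ≤ t → (t : EReal) < T → t - s ≤ 1 →
      ‖sewnPath μ t - sewnPath μ s - μ t s‖
        ≤ (M * (1 - q)⁻¹ + q ^ n * (B - M * (1 - q)⁻¹)) * (t - s) ^ θ := by
    intro n
    induction n with
    | zero => simpa using coarse
    | succ n ih =>
      intro s t hs hst ht hts
      have hsm : s ≤ (s + t) / 2 := by linarith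
      have hmt : (s + t) / 2 ≤ t := by linarith
      have h1 := ih s _ hs hsm (EReal.coe_lt_of_le_of_lt hmt ht) (by linarith)
      have h2 := ih _ t (hs.trans hsm) hmt ht (by linarith)
      have h3 := hμ s _ t hs hsm hmt ht hts
      have e : sewnPath μ t - sewnPath μ s - μ t s
          = (sewnPath μ ((s + t) / 2) - sewnPath μ s - μ ((s + t) / 2) s)
            + (sewnPath μ t - sewnPath μ ((s + t) / 2) - μ t ((s + t) / 2))
            - increment μ t ((s + t) / 2) s := by
        rw [increment]
        abel
      have hhalf : ((1 / 2) * (t - s)) ^ θ = (1 / 2 : ℝ) ^ θ * (t - s) ^ θ :=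
        Real.mul_rpow (by norm_num) (by linarith)
      rw [show (s + t) / 2 - s = (1 / 2) * (t - s) by ring, hhalf] at h1
      rw [show t - (s + t) / 2 = (1 / 2) * (t - s) by ring, hhalf] at h2
      rw [e]
      refine (norm_sub_le _ _).trans ((add_le_add (norm_add_le _ _) le_rfl).trans
        ((add_le_add (add_le_add h1 h2) h3).trans (le_of_eq ?_)))
      have hfix : M * (1 - q)⁻¹ = q * (M * (1 - q)⁻¹) + M := by
        field_simp
        ring
      rw [pow_succ]
      linear_combination (-(t - s) ^ θ) * hfix
        - (M * (1 - q)⁻¹ + q ^ n * (B - M * (1 - q)⁻¹)) * (t - s) ^ θ * hqdef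
  have hlim : Filter.Tendsto
      (fun n : ℕ ↦ (M * (1 - q)⁻¹ + q ^ n * (B - M * (1 - q)⁻¹)) * (t - s) ^ θ) Filter.atTop
      (nhds ((M * (1 - q)⁻¹ + 0 * (B - M * (1 - q)⁻¹)) * (t - s) ^ θ)) :=
    (((tendsto_pow_atTop_nhds_zero_of_lt_one hq0 hq).mul_const _).const_add _).mul_const _
  rw [zero_mul, add_zero] at hlim
  exact ge_of_tendsto' hlim fun n ↦ refined n s t hs hst ht hts

end Sewing

section Convolution

lemma sum_Ico_mul_assoc {R : Type*} [Ring R] {n : ℕ} {a b c ab bc : ℕ → R}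
    (hab : ∀ m ∈ Finset.Ico 1 n, ab m - a m - b m = ∑ j ∈ Finset.Ico 1 m, a (m - j) * b j)
    (hbc : ∀ m ∈ Finset.Ico 1 n, bc m - b m - c m = ∑ j ∈ Finset.Ico 1 m, b (m - j) * c j) :
    ∑ k ∈ Finset.Ico 1 n, ab (n - k) * c k - ∑ k ∈ Finset.Ico 1 n, a (n - k) * bc k
        - ∑ k ∈ Finset.Ico 1 n, b (n - k) * c k
      = -∑ k ∈ Finset.Ico 1 n, a (n - k) * b k := by
  have h1 : ∑ k ∈ Finset.Ico 1 n, ab (n - k) * c k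
      = ∑ k ∈ Finset.Ico 1 n, a (n - k) * c k + ∑ k ∈ Finset.Ico 1 n, b (n - k) * c k
        + ∑ k ∈ Finset.Ico 1 n, ∑ j ∈ Finset.Ico 1 (n - k), a (n - k - j) * b j * c k := by
    rw [← Finset.sum_add_distrib, ← Finset.sum_add_distrib]
    refine Finset.sum_congr rfl fun k hk ↦ ?_
    rw [Finset.mem_Ico] at hk
    rw [← Finset.sum_mul, ← hab (n - k) (Finset.mem_Ico.2 (by omega))]
    noncomm_ring
  have h2 : ∑ k ∈ Finset.Ico 1 n, a (n - k) * bc k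
      = ∑ k ∈ Finset.Ico 1 n, a (n - k) * b k + ∑ k ∈ Finset.Ico 1 n, a (n - k) * c k
        + ∑ k ∈ Finset.Ico 1 n, ∑ i ∈ Finset.Ico 1 k, a (n - k) * (b (k - i) * c i) := by
    rw [← Finset.sum_add_distrib, ← Finset.sum_add_distrib]
    refine Finset.sum_congr rfl fun k hk ↦ ?_
    rw [← Finset.mul_sum, ← hbc k hk]
    noncomm_ring
  have h3 : ∑ k ∈ Finset.Ico 1 n, ∑ j ∈ Finset.Ico 1 (n - k), a (n - k - j) * b j * c k
      = ∑ k ∈ Finset.Ico 1 n, ∑ i ∈ Finset.Ico 1 k, a (n - k) * (b (k - i) * c i) := by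
    rw [Finset.sum_sigma', Finset.sum_sigma']
    refine Finset.sum_nbij' (fun p ↦ ⟨p.1 + p.2, p.1⟩) (fun p ↦ ⟨p.2, p.1 - p.2⟩) ?_ ?_ ?_ ?_ ?_
    · rintro ⟨k, j⟩ h
      simp only [Finset.mem_sigma, Finset.mem_Ico] at h ⊢
      omega
    · rintro ⟨k, j⟩ h
      simp only [Finset.mem_sigma, Finset.mem_Ico] at h ⊢
      omega
    · rintro ⟨k, j⟩ h
      simp
    · rintro ⟨k, j⟩ h
      simp only [Finset.mem_sigma, Finset.mem_Ico] at h
      simp only [Sigma.mk.injEq, heq_eq_eq, and_true]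
      omega
    · rintro ⟨k, j⟩ h
      simp only [Nat.sub_add_eq, Nat.add_sub_cancel_left, mul_assoc]
  rw [h1, h2, h3]
  abel

lemma pow_div_factorial_mul_le {x y : ℝ} (hx : 0 ≤ x) (hy : 0 ≤ y) {n k : ℕ} (hk : k ≤ n) :
    x ^ (n - k) / (n - k).factorial * (y ^ k / k.factorial) ≤ (x + y) ^ n / n.factorial := by
  have h : y ^ k * x ^ (n - k) * (n.choose k) ≤ (y + x) ^ n := by
    rw [add_pow]
    exact Finset.single_le_sum (f := fun m ↦ y ^ m * x ^ (n - m) * (n.choose m))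
      (fun _ _ ↦ by positivity) (Finset.mem_range.2 (by omega))
  rw [Nat.cast_choose ℝ hk] at h
  rw [le_div_iff₀ (by positivity), add_comm x y]
  calc _ = _ := ?_
    _ ≤ _ := h
  field_simp

lemma sum_inv_sq_mul_inv_sq_le (n : ℕ) :
    ∑ k ∈ Finset.Ico 1 n, (((n - k : ℕ) : ℝ) ^ 2)⁻¹ * ((k : ℝ) ^ 2)⁻¹ ≤ 8 * ((n : ℝ) ^ 2)⁻¹ := by
  have hs : ∑ k ∈ Finset.Ico 1 n, ((k : ℝ) ^ 2)⁻¹ ≤ 2 := by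
    have h := sum_Ioo_inv_sq_le (α := ℝ) 0 n
    rw [Nat.cast_zero, zero_add, div_one] at h
    exact h
  have hr : ∑ k ∈ Finset.Ico 1 n, (((n - k : ℕ) : ℝ) ^ 2)⁻¹
      = ∑ k ∈ Finset.Ico 1 n, ((k : ℝ) ^ 2)⁻¹ := by
    refine Finset.sum_nbij' (fun k ↦ n - k) (fun k ↦ n - k) ?_ ?_ ?_ ?_ ?_ <;>
      intro k hk <;> simp only [Finset.mem_Ico] at hk ⊢ <;> omega
  calc _ ≤ ∑ k ∈ Finset.Ico 1 n,
        2 * ((n : ℝ) ^ 2)⁻¹ * ((((n - k : ℕ) : ℝ) ^ 2)⁻¹ + ((k : ℝ) ^ 2)⁻¹) := by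
        refine Finset.sum_le_sum fun k hk ↦ ?_
        rw [Finset.mem_Ico] at hk
        have hk0 : (0 : ℝ) < k := by exact_mod_cast hk.1
        have hj0 : (0 : ℝ) < (n - k : ℕ) := by exact_mod_cast (by omega : 0 < n - k)
        have hn : (n : ℝ) = (n - k : ℕ) + k := by rw [Nat.cast_sub hk.2.le]; ring
        rw [hn]
        set j : ℝ := ((n - k : ℕ) : ℝ)
        have e : 2 * ((j + k) ^ 2)⁻¹ * ((j ^ 2)⁻¹ + ((k : ℝ) ^ 2)⁻¹)
            - (j ^ 2)⁻¹ * ((k : ℝ) ^ 2)⁻¹ = (j - k) ^ 2 * (((j + k) * j * k) ^ 2)⁻¹ := by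
          field_simp
          ring
        have : 0 ≤ (j - k) ^ 2 * (((j + k) * j * k) ^ 2)⁻¹ := by positivity
        linarith
    _ = 2 * ((n : ℝ) ^ 2)⁻¹ * (2 * ∑ k ∈ Finset.Ico 1 n, ((k : ℝ) ^ 2)⁻¹) := by
        rw [← Finset.mul_sum, Finset.sum_add_distrib, hr, two_mul (∑ k ∈ _, _)]
    _ ≤ 2 * ((n : ℝ) ^ 2)⁻¹ * (2 * 2) := by gcongr
    _ = _ := by ring

lemma norm_sum_Ico_mul_le {R : Type*} [NormedRing R] {γ c C x y : ℝ} (hγ : 0 ≤ γ) (hC : 0 ≤ C)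
    (hc : 0 ≤ c) (hx : 0 ≤ x) (hy : 0 ≤ y) {n : ℕ} {a b : ℕ → R}
    (ha : ∀ k ∈ Finset.Ico 1 n, ‖a k‖ ≤ c * C ^ k * ((k : ℝ) ^ 2)⁻¹ * (x ^ k / k.factorial) ^ γ)
    (hb : ∀ k ∈ Finset.Ico 1 n, ‖b k‖ ≤ c * C ^ k * ((k : ℝ) ^ 2)⁻¹ * (y ^ k / k.factorial) ^ γ) :
    ‖∑ k ∈ Finset.Ico 1 n, a (n - k) * b k‖
      ≤ 8 * c ^ 2 * C ^ n * ((n : ℝ) ^ 2)⁻¹ * ((x + y) ^ n / n.factorial) ^ γ := by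
  have hterm : ∀ k ∈ Finset.Ico 1 n, ‖a (n - k) * b k‖
      ≤ c ^ 2 * C ^ n * ((x + y) ^ n / n.factorial) ^ γ
        * ((((n - k : ℕ) : ℝ) ^ 2)⁻¹ * ((k : ℝ) ^ 2)⁻¹) := by
    intro k hk
    have hk' := Finset.mem_Ico.1 hk
    have h1 := ha (n - k) (Finset.mem_Ico.2 (by omega))
    have h2 : (x ^ (n - k) / (n - k).factorial) ^ γ * (y ^ k / k.factorial) ^ γ
        ≤ ((x + y) ^ n / n.factorial) ^ γ := by
      rw [← Real.mul_rpow (by positivity) (by positivity)]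
      exact Real.rpow_le_rpow (by positivity) (pow_div_factorial_mul_le hx hy hk'.2.le) hγ
    have hCn : C ^ n = C ^ (n - k) * C ^ k := by rw [← pow_add, Nat.sub_add_cancel hk'.2.le]
    calc _ ≤ ‖a (n - k)‖ * ‖b k‖ := norm_mul_le _ _
      _ ≤ (c * C ^ (n - k) * (((n - k : ℕ) : ℝ) ^ 2)⁻¹ * (x ^ (n - k) / (n - k).factorial) ^ γ)
          * (c * C ^ k * ((k : ℝ) ^ 2)⁻¹ * (y ^ k / k.factorial) ^ γ) :=
          mul_le_mul h1 (hb k hk) (norm_nonneg _) (by positivity)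
      _ = c ^ 2 * C ^ n
          * ((x ^ (n - k) / (n - k).factorial) ^ γ * (y ^ k / k.factorial) ^ γ)
          * ((((n - k : ℕ) : ℝ) ^ 2)⁻¹ * ((k : ℝ) ^ 2)⁻¹) := by rw [hCn]; ring
      _ ≤ _ := by gcongr
  refine (norm_sum_le_of_le _ hterm).trans ?_
  rw [← Finset.mul_sum]
  calc _ ≤ c ^ 2 * C ^ n * ((x + y) ^ n / n.factorial) ^ γ * (8 * ((n : ℝ) ^ 2)⁻¹) := by
        gcongr
        exact sum_inv_sq_mul_inv_sq_le n
    _ = _ := by ring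

end Convolution

section Extension

variable {A : Type} [NormedRing A] {T : EReal} {A1 A2 : ℝ → ℝ → A}

/-- The hierarchy `(Aⁿ)` over `(A¹, A²)`: for `n ≥ 3` the path `t ↦ Aⁿ_{t0}` is obtained by sewing
the germ `∑ Aⁿ⁻ᵏ_{ts} Aᵏ_{s0}`. -/
noncomputable def lyonsExtension (A1 A2 : ℝ → ℝ → A) : ℕ → ℝ → ℝ → A
  | 0 => fun _ _ ↦ 1
  | 1 => A1
  | 2 => A2
  | n + 3 =>
    let μ : ℝ → ℝ → A := fun t s ↦ ∑ k : Fin (n + 2),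
      lyonsExtension A1 A2 (n + 2 - k) t s * lyonsExtension A1 A2 (k + 1) s 0
    fun t s ↦ sewnPath μ t - sewnPath μ s - μ t s
  decreasing_by all_goals omega

/-- The germ whose sewing is the path `t ↦ Aⁿ_{t0}`. -/
noncomputable def lyonsGerm (A1 A2 : ℝ → ℝ → A) (n : ℕ) (t s : ℝ) : A :=
  ∑ k ∈ Finset.Ico 1 n, lyonsExtension A1 A2 (n - k) t s * lyonsExtension A1 A2 k s 0

lemma lyonsExtension_of_three_le {n : ℕ} (hn : 3 ≤ n) (t s : ℝ) :
    lyonsExtension A1 A2 n t s = sewnPath (lyonsGerm A1 A2 n) t - sewnPath (lyonsGerm A1 A2 n) s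
      - lyonsGerm A1 A2 n t s := by
  obtain ⟨n, rfl⟩ := Nat.exists_eq_add_of_le' hn
  have h : lyonsGerm A1 A2 (n + 3) = fun t s ↦ ∑ k : Fin (n + 2),
      lyonsExtension A1 A2 (n + 2 - k) t s * lyonsExtension A1 A2 (k + 1) s 0 := by
    funext t s
    rw [lyonsGerm, Finset.sum_Ico_eq_sum_range, ← Fin.sum_univ_eq_sum_range
      (fun k ↦ lyonsExtension A1 A2 (n + 3 - (1 + k)) t s * lyonsExtension A1 A2 (1 + k) s 0)]
    refine Fintype.sum_congr _ _ fun k ↦ ?_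
    rw [add_comm 1 (k : ℕ), Nat.add_sub_add_right (n + 2) 1 k]
  rw [h, lyonsExtension]

/-- Chen's relation at level `n` for a hierarchy of 2-index maps. -/
def ChenAt (T : EReal) (B : ℕ → ℝ → ℝ → A) (n : ℕ) : Prop :=
  ∀ s u t : ℝ, 0 ≤ s → s ≤ u → u ≤ t → (t : EReal) < T →
    B n t s - B n t u - B n u s = ∑ k ∈ Finset.Ico 1 n, B (n - k) t u * B k u s

/-- The inductive form of the factorial bound at level `n`. -/
def FactorialBoundAt (T : EReal) (γ c C : ℝ) (B : ℕ → ℝ → ℝ → A) (n : ℕ) : Prop :=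
  ∀ s t : ℝ, 0 ≤ s → s ≤ t → (t : EReal) < T → t - s ≤ 1 →
    ‖B n t s‖ ≤ c * C ^ n * ((n : ℝ) ^ 2)⁻¹ * ((t - s) ^ n / n.factorial) ^ γ

lemma pow_div_factorial_rpow {x : ℝ} (hx : 0 ≤ x) (n : ℕ) (γ : ℝ) :
    (x ^ n / n.factorial) ^ γ = (n.factorial : ℝ) ^ (-γ) * x ^ (n * γ) := by
  rw [Real.div_rpow (by positivity) (by positivity), Real.rpow_neg (by positivity),
    ← Real.rpow_natCast_mul hx, div_eq_inv_mul]

lemma increment_lyonsGerm {n : ℕ}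
    (hchen : ∀ m ∈ Finset.Ico 1 n, ChenAt T (lyonsExtension A1 A2) m)
    {s u t : ℝ} (hs : 0 ≤ s) (hsu : s ≤ u) (hut : u ≤ t) (ht : (t : EReal) < T) :
    increment (lyonsGerm A1 A2 n) t u s
      = -∑ k ∈ Finset.Ico 1 n,
          lyonsExtension A1 A2 (n - k) t u * lyonsExtension A1 A2 k u s :=
  sum_Ico_mul_assoc (a := fun m ↦ lyonsExtension A1 A2 m t u)
    (b := fun m ↦ lyonsExtension A1 A2 m u s) (c := fun m ↦ lyonsExtension A1 A2 m s 0)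
    (ab := fun m ↦ lyonsExtension A1 A2 m t s) (bc := fun m ↦ lyonsExtension A1 A2 m u 0)
    (fun m hm ↦ hchen m hm s u t hs hsu hut ht)
    (fun m hm ↦ hchen m hm 0 s u le_rfl hs hsu (EReal.coe_lt_of_le_of_lt hut ht))

lemma lyonsExtension_step [CompleteSpace A] {γ c C : ℝ} (hγ : 1 / 3 < γ) (hC : 0 ≤ C)
    (hc : 8 * c = 1 - 2 * (1 / 2 : ℝ) ^ (3 * γ)) {n : ℕ} (hn : 3 ≤ n)
    (hchen : ∀ m ∈ Finset.Ico 1 n, ChenAt T (lyonsExtension A1 A2) m)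
    (hbd : ∀ m ∈ Finset.Ico 1 n, FactorialBoundAt T γ c C (lyonsExtension A1 A2) m) :
    ChenAt T (lyonsExtension A1 A2) n ∧ FactorialBoundAt T γ c C (lyonsExtension A1 A2) n := by
  have hc0 : 0 < c := by
    have := two_mul_half_rpow_lt_one (θ := 3 * γ) (by linarith)
    linarith
  have hn3 : (3 : ℝ) ≤ n := by exact_mod_cast hn
  have hθ3 : 3 * γ ≤ n * γ := by gcongr
  have hθ : 1 < n * γ := by linarith
  refine ⟨fun s u t hs hsu hut ht ↦ ?_, fun s t hs hst ht hts ↦ ?_⟩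
  · have h := increment_lyonsGerm hchen hs hsu hut ht
    rw [increment] at h
    simp only [lyonsExtension_of_three_le hn]
    rw [← neg_eq_iff_eq_neg.2 h]
    abel
  · set M := 8 * c ^ 2 * C ^ n * ((n : ℝ) ^ 2)⁻¹ * (n.factorial : ℝ) ^ (-γ) with hMdef
    have hM : 0 ≤ M := by positivity
    have hμ : IncrementBound T (n * γ) M (lyonsGerm A1 A2 n) := by
      intro s u t hs hsu hut ht hts
      rw [increment_lyonsGerm hchen hs hsu hut ht, norm_neg]
      refine (norm_sum_Ico_mul_le (by linarith) hC hc0.le (sub_nonneg.2 hut) (sub_nonneg.2 hsu)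
        (a := fun m ↦ lyonsExtension A1 A2 m t u) (b := fun m ↦ lyonsExtension A1 A2 m u s)
        (fun k hk ↦ hbd k hk u t (hs.trans hsu) hut ht (by linarith))
        (fun k hk ↦ hbd k hk s u hs hsu (EReal.coe_lt_of_le_of_lt hut ht) (by linarith))).trans
        (le_of_eq ?_)
      rw [sub_add_sub_cancel, pow_div_factorial_rpow (by linarith)]
      ring
    rw [lyonsExtension_of_three_le hn]
    refine (norm_sewnPath_sub_sub_le hμ hM hθ hs hst ht hts).trans ?_
    rw [pow_div_factorial_rpow (sub_nonneg.2 hst), ← mul_assoc]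
    have hmono : (1 / 2 : ℝ) ^ (n * γ) ≤ (1 / 2 : ℝ) ^ (3 * γ) :=
      Real.rpow_le_rpow_of_exponent_ge (by norm_num) (by norm_num) hθ3
    have hinv : (1 - 2 * (1 / 2 : ℝ) ^ (n * γ))⁻¹ ≤ (8 * c)⁻¹ :=
      inv_anti₀ (by positivity) (by linarith)
    have hx : 0 ≤ (t - s) ^ (n * γ) := Real.rpow_nonneg (sub_nonneg.2 hst) _
    refine mul_le_mul_of_nonneg_right ?_ hx
    calc M * (1 - 2 * (1 / 2 : ℝ) ^ (n * γ))⁻¹ ≤ M * (8 * c)⁻¹ := by gcongr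
      _ = _ := by rw [hMdef]; field_simp

lemma lyonsExtension_chen_and_bound [CompleteSpace A] {γ c C K : ℝ} (hγ1 : 1 / 3 < γ)
    (hγ2 : γ ≤ 1 / 2) (hc : 8 * c = 1 - 2 * (1 / 2 : ℝ) ^ (3 * γ)) (hC : C = 1 + 8 * |K| / c)
    (hchen : ChenRelations T A1 A2) (hK : DriverNormBound γ T A1 A2 K) {n : ℕ} (hn : 1 ≤ n) :
    ChenAt T (lyonsExtension A1 A2) n ∧ FactorialBoundAt T γ c C (lyonsExtension A1 A2) n := by
  have hc0 : 0 < c := by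
    have := two_mul_half_rpow_lt_one (θ := 3 * γ) (by linarith)
    linarith
  have hC1 : 1 ≤ C := by
    rw [hC]
    have : 0 ≤ 8 * |K| / c := by positivity
    linarith
  have hcC : 8 * K ≤ c * C := by
    have : c * C = c + 8 * |K| := by rw [hC]; field_simp
    linarith [le_abs_self K]
  have hcC0 : 0 < c * C := by positivity
  have e1 : lyonsExtension A1 A2 1 = A1 := by rw [lyonsExtension]
  have e2 : lyonsExtension A1 A2 2 = A2 := by rw [lyonsExtension]
  induction n using Nat.strong_induction_on with
  | _ n ih =>
    rcases (show n = 1 ∨ n = 2 ∨ 3 ≤ n by omega) with rfl | rfl | h3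
    · refine ⟨fun s u t hs hsu hut ht ↦ ?_, fun s t hs hst ht hts ↦ ?_⟩
      · rw [e1, (hchen s u t hs hsu hut ht).1]
        simp
      · rw [e1]
        refine (hK s t hs hst ht hts).1.trans ?_
        have hx : 0 ≤ (t - s) ^ γ := Real.rpow_nonneg (sub_nonneg.2 hst) _
        simp only [pow_one, Nat.cast_one, one_pow, inv_one, mul_one, Nat.factorial_one, div_one]
        exact mul_le_mul_of_nonneg_right (by linarith) hx
    · refine ⟨fun s u t hs hsu hut ht ↦ ?_, fun s t hs hst ht hts ↦ ?_⟩
      · rw [e2, (hchen s u t hs hsu hut ht).2, show Finset.Ico 1 2 = {1} from rfl,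
          Finset.sum_singleton, show 2 - 1 = 1 from rfl, e1]
        abel
      · rw [e2]
        refine (hK s t hs hst ht hts).2.trans ?_
        have hx : 0 ≤ (t - s) ^ (2 * γ) := Real.rpow_nonneg (sub_nonneg.2 hst) _
        rw [pow_div_factorial_rpow (sub_nonneg.2 hst), Nat.cast_ofNat, ← mul_assoc]
        refine mul_le_mul_of_nonneg_right ?_ hx
        have h2 : (1 / 2 : ℝ) ≤ ((2 : ℕ).factorial : ℝ) ^ (-γ) := by
          rw [Nat.factorial_two, Nat.cast_ofNat, one_div, ← Real.rpow_neg_one]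
          exact Real.rpow_le_rpow_of_exponent_le (by norm_num) (by linarith)
        calc K ≤ c * C * 1 * (2 ^ 2)⁻¹ * (1 / 2) := by linarith
          _ ≤ c * C * C * (2 ^ 2)⁻¹ * ((2 : ℕ).factorial : ℝ) ^ (-γ) := by gcongr
          _ = _ := by ring
    · have ih' : ∀ m ∈ Finset.Ico 1 n, _ := fun m hm ↦
        ih m (Finset.mem_Ico.1 hm).2 (Finset.mem_Ico.1 hm).1
      exact lyonsExtension_step hγ1 (by linarith) hc h3 (fun m hm ↦ (ih' m hm).1)
        (fun m hm ↦ (ih' m hm).2)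

end Extension

section Exponential

lemma summable_pow_mul_factorial_rpow {γ C : ℝ} (hγ : 0 < γ) (hC : 0 < C) :
    Summable fun n : ℕ ↦ C ^ n * (n.factorial : ℝ) ^ (-γ) := by
  refine summable_of_ratio_test_tendsto_lt_one (l := 0) one_pos
    (Filter.Eventually.of_forall fun n ↦ by positivity) ?_
  have h : ∀ n : ℕ, ‖C ^ (n + 1) * ((n + 1).factorial : ℝ) ^ (-γ)‖
      / ‖C ^ n * (n.factorial : ℝ) ^ (-γ)‖ = C * ((n + 1 : ℕ) : ℝ) ^ (-γ) := by
    intro n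
    rw [Real.norm_of_nonneg (by positivity), Real.norm_of_nonneg (by positivity),
      Nat.factorial_succ, Nat.cast_mul, Real.mul_rpow (by positivity) (by positivity)]
    field_simp
    ring
  simp only [h]
  have h1 := (tendsto_rpow_neg_atTop hγ).comp
    (tendsto_natCast_atTop_atTop.comp (Filter.tendsto_add_atTop_nat 1))
  simpa using h1.const_mul C

variable {A : Type} [NormedRing A] {T : EReal} {B : ℕ → ℝ → ℝ → A} {γ C : ℝ}

/-- The factorial decay `‖Bⁿ_{ts}‖ ≤ Cⁿ (n!)^{-γ} (t - s)^{nγ}` for all `n ≥ 1`. -/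
def FactorialDecay (T : EReal) (γ C : ℝ) (B : ℕ → ℝ → ℝ → A) : Prop :=
  ∀ n : ℕ, 1 ≤ n → ∀ s t : ℝ, 0 ≤ s → s ≤ t → (t : EReal) < T → t - s ≤ 1 →
    ‖B n t s‖ ≤ C ^ n * (n.factorial : ℝ) ^ (-γ) * (t - s) ^ (n * γ)

lemma FactorialBoundAt.factorial_decay {c : ℝ} (hc1 : c ≤ 1) (hC : 0 ≤ C)
    (h : ∀ n, 1 ≤ n → FactorialBoundAt T γ c C B n) : FactorialDecay T γ C B := by
  intro n hn s t hs hst ht hts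
  refine (h n hn s t hs hst ht hts).trans ?_
  have hx := sub_nonneg.2 hst
  have hn1 : ((n : ℝ) ^ 2)⁻¹ ≤ 1 := inv_le_one_of_one_le₀ (one_le_pow₀ (by exact_mod_cast hn))
  rw [pow_div_factorial_rpow hx, mul_assoc (C ^ n)]
  calc _ ≤ 1 * C ^ n * 1 * ((n.factorial : ℝ) ^ (-γ) * (t - s) ^ (n * γ)) := by gcongr
    _ = _ := by ring

lemma FactorialDecay.norm_add_le (hB : FactorialDecay T γ C B) (hγ : 0 ≤ γ) (hC : 0 ≤ C) {m : ℕ}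
    (hm : 1 ≤ m) {s t : ℝ} (hs : 0 ≤ s) (hst : s ≤ t) (ht : (t : EReal) < T) (hts : t - s ≤ 1)
    (n : ℕ) : ‖B (n + m) t s‖
      ≤ C ^ (n + m) * ((n + m).factorial : ℝ) ^ (-γ) * (t - s) ^ (m * γ) := by
  refine (hB (n + m) (by omega) s t hs hst ht hts).trans ?_
  refine mul_le_mul_of_nonneg_left ?_ (by positivity)
  refine Real.rpow_le_rpow_of_exponent_ge' (sub_nonneg.2 hst) hts (by positivity) ?_
  gcongr
  omega

lemma FactorialDecay.summable_norm (hB : FactorialDecay T γ C B) (hγ : 0 < γ) (hC : 0 < C)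
    {s t : ℝ} (hs : 0 ≤ s) (hst : s ≤ t) (ht : (t : EReal) < T) (hts : t - s ≤ 1) :
    Summable fun n ↦ ‖B n t s‖ := by
  rw [← summable_nat_add_iff 1]
  exact Summable.of_nonneg_of_le (fun _ ↦ norm_nonneg _)
    (hB.norm_add_le hγ.le hC.le le_rfl hs hst ht hts)
    (((summable_nat_add_iff 1).2 (summable_pow_mul_factorial_rpow hγ hC)).mul_right _)

lemma FactorialDecay.norm_tsum_sub_le [CompleteSpace A] (hB : FactorialDecay T γ C B) (hγ : 0 < γ)
    (hC : 0 < C) {m : ℕ} (hm : 1 ≤ m) {s t : ℝ} (hs : 0 ≤ s) (hst : s ≤ t) (ht : (t : EReal) < T)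
    (hts : t - s ≤ 1) :
    ‖∑' n, B n t s - ∑ n ∈ Finset.range m, B n t s‖
      ≤ (∑' n : ℕ, C ^ (n + m) * ((n + m).factorial : ℝ) ^ (-γ)) * (t - s) ^ (m * γ) := by
  rw [← (hB.summable_norm hγ hC hs hst ht hts).of_norm.sum_add_tsum_nat_add m, add_sub_cancel_left]
  exact tsum_of_norm_bounded
    ((((summable_nat_add_iff m).2 (summable_pow_mul_factorial_rpow hγ hC)).hasSum).mul_right _)
    (hB.norm_add_le hγ.le hC.le hm hs hst ht hts)

/-- `B` has unit at level zero and satisfies Chen's relations at all levels. -/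
def IsMultiplicative (T : EReal) (B : ℕ → ℝ → ℝ → A) : Prop :=
  (∀ t s, B 0 t s = 1) ∧ ∀ n, 1 ≤ n → ChenAt T B n

lemma IsMultiplicative.eq_sum_antidiagonal (hB : IsMultiplicative T B) {s u t : ℝ} (hs : 0 ≤ s)
    (hsu : s ≤ u) (hut : u ≤ t) (ht : (t : EReal) < T) (n : ℕ) :
    B n t s = ∑ p ∈ Finset.HasAntidiagonal.antidiagonal n, B p.1 t u * B p.2 u s := by
  rw [← Finset.Nat.sum_antidiagonal_swap, Finset.Nat.sum_antidiagonal_eq_sum_range_succ_mk]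
  rcases Nat.eq_zero_or_pos n with rfl | hn
  · simp [hB.1]
  · rw [Finset.sum_range_succ, Finset.range_eq_Ico, Finset.sum_eq_sum_Ico_succ_bot hn]
    simp only [Prod.fst_swap, Prod.snd_swap, Nat.sub_zero, Nat.sub_self, hB.1, one_mul, mul_one]
    rw [zero_add, ← hB.2 n hn s u t hs hsu hut ht]
    abel

lemma IsMultiplicative.summable_norm (hB : IsMultiplicative T B) {s u t : ℝ} (hs : 0 ≤ s)
    (hsu : s ≤ u) (hut : u ≤ t) (ht : (t : EReal) < T) (h1 : Summable fun n ↦ ‖B n t u‖)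
    (h2 : Summable fun n ↦ ‖B n u s‖) : Summable fun n ↦ ‖B n t s‖ := by
  have h := summable_norm_sum_mul_antidiagonal_of_summable_norm h1 h2
  exact h.congr fun n ↦ congrArg norm (hB.eq_sum_antidiagonal hs hsu hut ht n).symm

lemma IsMultiplicative.tsum_eq_mul [CompleteSpace A] (hB : IsMultiplicative T B) {s u t : ℝ}
    (hs : 0 ≤ s) (hsu : s ≤ u) (hut : u ≤ t) (ht : (t : EReal) < T)
    (h1 : Summable fun n ↦ ‖B n t u‖) (h2 : Summable fun n ↦ ‖B n u s‖) :
    ∑' n, B n t s = (∑' n, B n t u) * ∑' n, B n u s := by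
  rw [tsum_mul_tsum_eq_tsum_sum_antidiagonal_of_summable_norm h1 h2]
  exact tsum_congr (hB.eq_sum_antidiagonal hs hsu hut ht)

lemma exists_summable_and_norm_tsum_le [CompleteSpace A] (hB : IsMultiplicative T B)
    (hd : FactorialDecay T γ C B) (hγ : 0 < γ) (hC : 0 < C) (m : ℕ) :
    ∃ L : ℝ, 0 ≤ L ∧ ∀ s t : ℝ, 0 ≤ s → s ≤ t → (t : EReal) < T → t - s ≤ m →
      (Summable fun n ↦ ‖B n t s‖) ∧ ‖∑' n, B n t s‖ ≤ L := by
  set L₁ : ℝ := ∑' n : ℕ, C ^ (n + 1) * ((n + 1).factorial : ℝ) ^ (-γ)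
  have hL₁ : 0 ≤ L₁ := tsum_nonneg fun n ↦ by positivity
  have hshort : ∀ s t : ℝ, 0 ≤ s → s ≤ t → (t : EReal) < T → t - s ≤ 1 →
      ‖∑' n, B n t s‖ ≤ L₁ + ‖(1 : A)‖ := by
    intro s t hs hst ht hts
    have h := hd.norm_tsum_sub_le hγ hC le_rfl hs hst ht hts
    rw [Finset.sum_range_one, hB.1] at h
    have h1 : (t - s) ^ (((1 : ℕ) : ℝ) * γ) ≤ 1 :=
      Real.rpow_le_one (sub_nonneg.2 hst) hts (by positivity)
    calc _ = ‖(∑' n, B n t s - 1) + 1‖ := by rw [sub_add_cancel]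
      _ ≤ L₁ * 1 + ‖(1 : A)‖ := (norm_add_le _ _).trans (by gcongr; exact h.trans (by gcongr))
      _ = _ := by ring
  induction m with
  | zero =>
    refine ⟨L₁ + ‖(1 : A)‖, by positivity, fun s t hs hst ht hts ↦ ?_⟩
    have hts' : t - s ≤ 1 := by
      rw [Nat.cast_zero] at hts
      linarith
    exact ⟨hd.summable_norm hγ hC hs hst ht hts', hshort s t hs hst ht hts'⟩
  | succ m ih =>
    obtain ⟨L, hL, h⟩ := ih
    refine ⟨(L₁ + ‖(1 : A)‖) * L, by positivity, fun s t hs hst ht hts ↦ ?_⟩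
    push_cast at hts
    have hsu : s ≤ max s (t - 1) := le_max_left _ _
    have hut : max s (t - 1) ≤ t := max_le hst (by linarith)
    have htu : t - max s (t - 1) ≤ 1 := by linarith [le_max_right s (t - 1)]
    have hus : max s (t - 1) - s ≤ m := by
      rw [sub_le_iff_le_add]
      exact max_le (by linarith [m.cast_nonneg (α := ℝ)]) (by linarith)
    obtain ⟨h1, h2⟩ := h s _ hs hsu (EReal.coe_lt_of_le_of_lt hut ht) hus
    have h3 := hd.summable_norm hγ hC (hs.trans hsu) hut ht htu
    refine ⟨hB.summable_norm hs hsu hut ht h3 h1, ?_⟩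
    rw [hB.tsum_eq_mul hs hsu hut ht h3 h1]
    exact (norm_mul_le _ _).trans
      (mul_le_mul (hshort _ t (hs.trans hsu) hut ht htu) h2 (norm_nonneg _) (by positivity))

lemma summable_norm_of_isMultiplicative [CompleteSpace A] (hB : IsMultiplicative T B)
    (hd : FactorialDecay T γ C B) (hγ : 0 < γ) (hC : 0 < C) {s t : ℝ} (hs : 0 ≤ s) (hst : s ≤ t)
    (ht : (t : EReal) < T) : Summable fun n ↦ ‖B n t s‖ := by
  obtain ⟨m, hm⟩ := exists_nat_ge (t - s)
  obtain ⟨_, _, h⟩ := exists_summable_and_norm_tsum_le hB hd hγ hC m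
  exact (h s t hs hst ht hm).1

/-- Removing from the exponential its first `m` levels leaves an `mγ`-Hölder remainder. -/
lemma locallyHolderFrom_tsum_sub [CompleteSpace A] (hB : IsMultiplicative T B)
    (hd : FactorialDecay T γ C B) (hγ : 0 < γ) (hC : 0 < C) {m : ℕ} (hm : 1 ≤ m) {s : ℝ}
    (hs : 0 ≤ s) :
    LocallyHolderFrom (m * γ) s T fun t u ↦
      ∑' n, B n t s - (∑ n ∈ Finset.range m, B n t u) * ∑' n, B n u s := by
  intro S hS
  obtain ⟨k, hk⟩ := exists_nat_ge (S - s)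
  obtain ⟨L, hL, h⟩ := exists_summable_and_norm_tsum_le hB hd hγ hC k
  refine ⟨(∑' n : ℕ, C ^ (n + m) * ((n + m).factorial : ℝ) ^ (-γ)) * L,
    fun u t hsu hut htS htu ↦ ?_⟩
  have ht := EReal.coe_lt_of_le_of_lt htS hS
  have hu := EReal.coe_lt_of_le_of_lt hut ht
  obtain ⟨h1, h2⟩ := h s u hs hsu hu (by linarith)
  have hu0 := hs.trans hsu
  have h3 := hd.norm_tsum_sub_le hγ hC hm hu0 hut ht htu
  dsimp only
  rw [hB.tsum_eq_mul hs hsu hut ht (hd.summable_norm hγ hC hu0 hut ht htu) h1, ← sub_mul,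
    mul_right_comm]
  exact (norm_mul_le _ _).trans
    (mul_le_mul h3 h2 (norm_nonneg _) ((norm_nonneg _).trans h3))

end Exponential

theorem lyons_extension_bounded_rough_driver
    (γ : ℝ) (hγ1 : 1 / 3 < γ) (hγ2 : γ ≤ 1 / 2) (K : ℝ) :
    ∃ C : ℝ, 0 < C ∧
      ∀ (A : Type) [NormedRing A] [NormedAlgebra ℝ A] [CompleteSpace A]
        (T : EReal), 0 < T →
      ∀ (A1 A2 : ℝ → ℝ → A), ChenRelations T A1 A2 →
        DriverNormBound γ T A1 A2 K →
      ∃ Aseq : ℕ → ℝ → ℝ → A,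
        (∀ s t : ℝ, 0 ≤ s → s ≤ t → (t : EReal) < T →
          Aseq 0 t s = 1 ∧ Aseq 1 t s = A1 t s ∧ Aseq 2 t s = A2 t s) ∧
        (∀ n : ℕ, 2 ≤ n → ∀ s u t : ℝ, 0 ≤ s → s ≤ u → u ≤ t → (t : EReal) < T →
          Aseq n t s - Aseq n t u - Aseq n u s =
            ∑ k ∈ Finset.Ico 1 n, Aseq (n - k) t u * Aseq k u s) ∧
        (∀ n : ℕ, 1 ≤ n → ∀ s t : ℝ, 0 ≤ s → s ≤ t → (t : EReal) < T → t - s ≤ 1 →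
          ‖Aseq n t s‖ ≤ C ^ n * ((n.factorial : ℝ)) ^ (-γ) * (t - s) ^ ((n : ℝ) * γ)) ∧
        (∀ s t : ℝ, 0 ≤ s → s ≤ t → (t : EReal) < T →
          Summable (fun n => ‖Aseq n t s‖)) ∧
        (∀ s u t : ℝ, 0 ≤ s → s ≤ u → u ≤ t → (t : EReal) < T →
          (∑' n, Aseq n t s) = (∑' n, Aseq n t u) * (∑' n, Aseq n u s)) ∧
        (∀ s : ℝ, 0 ≤ s → (s : EReal) < T →
          LocallyHolderFrom γ s T
            (fun t u => (∑' n, Aseq n t s) - (∑' n, Aseq n u s)) ∧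
          LocallyHolderFrom (3 * γ) s T
            (fun t u => (∑' n, Aseq n t s) - (∑' n, Aseq n u s)
              - (A1 t u + A2 t u) * (∑' n, Aseq n u s))) := by
  set c : ℝ := (1 - 2 * (1 / 2 : ℝ) ^ (3 * γ)) / 8 with hcdef
  have hγ : 0 < γ := by linarith
  have hc0 : 0 < c := by
    have := two_mul_half_rpow_lt_one (θ := 3 * γ) (by linarith)
    rw [hcdef]
    linarith
  have hc1 : c ≤ 1 := by
    have : 0 < (1 / 2 : ℝ) ^ (3 * γ) := by positivity
    rw [hcdef]
    linarith
  have hC0 : 0 < 1 + 8 * |K| / c := by positivity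
  refine ⟨1 + 8 * |K| / c, hC0, fun A _ _ _ T _ A1 A2 hchen hK ↦ ?_⟩
  have hmain : ∀ n, 1 ≤ n → _ := fun n hn ↦
    lyonsExtension_chen_and_bound (c := c) (n := n) hγ1 hγ2 (by rw [hcdef]; ring) rfl hchen hK hn
  have e0 : ∀ t s, lyonsExtension A1 A2 0 t s = 1 := fun t s ↦ by rw [lyonsExtension]
  have e1 : ∀ t s, lyonsExtension A1 A2 1 t s = A1 t s := fun t s ↦ by rw [lyonsExtension]
  have e2 : ∀ t s, lyonsExtension A1 A2 2 t s = A2 t s := fun t s ↦ by rw [lyonsExtension]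
  have hB : IsMultiplicative T (lyonsExtension A1 A2) := ⟨e0, fun n hn ↦ (hmain n hn).1⟩
  have hd : FactorialDecay T γ (1 + 8 * |K| / c) (lyonsExtension A1 A2) :=
    FactorialBoundAt.factorial_decay hc1 hC0.le fun n hn ↦ (hmain n hn).2
  have hsum : ∀ s t : ℝ, 0 ≤ s → s ≤ t → (t : EReal) < T → _ := fun s t hs hst ht ↦
    summable_norm_of_isMultiplicative hB hd hγ hC0 hs hst ht
  refine ⟨lyonsExtension A1 A2, fun s t _ _ _ ↦ ⟨e0 t s, e1 t s, e2 t s⟩,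
    fun n hn ↦ hB.2 n (by omega), hd, hsum, fun s u t hs hsu hut ht ↦ ?_, fun s hs _ ↦ ⟨?_, ?_⟩⟩
  · exact hB.tsum_eq_mul hs hsu hut ht (hsum u t (hs.trans hsu) hut ht)
      (hsum s u hs hsu (EReal.coe_lt_of_le_of_lt hut ht))
  · simpa [e0] using locallyHolderFrom_tsum_sub hB hd hγ hC0 le_rfl hs
  · have h := locallyHolderFrom_tsum_sub hB hd hγ hC0 (m := 3) (by norm_num) hs
    simpa only [Finset.sum_range_succ, Finset.sum_range_zero, zero_add, e0, e1, e2, add_assoc,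
      add_mul, one_mul, sub_add_eq_sub_sub, Nat.cast_ofNat] using h
end
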